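/- arXiv:1509.00684 — 4 statements merged into one kernel-verified Lean document; each statement's English description precedes it below -/
import Mathlib

section
/- Let G = (V,E) be a finite loopless directed graph, and for an L-drawing given by injective maps x, y : V → ℤ define the horizontal ink ink_x as the sum over v ∈ V of the total length of the union of the horizontal edge segments lying on the row y(v), and the vertical ink ink_y as the sum over v ∈ V of the total length of the union of the vertical edge segments lying on the column x(v). Then ink_x = Σ_{v ∈ V} (max_{u ∈ N⁻(v) ∪ {v}} x(u) − min_{u ∈ N⁻(v) ∪ {v}} x(u)) and ink_y = Σ_{v ∈ V} (max_{w ∈ N⁺(v) ∪ {v}} y(w) − min_{w ∈ N⁺(v) ∪ {v}} y(w)); consequently ink_x depends only on the map x (it is unchanged when y is replaced by any other injective map y'), and symmetrically ink_y depends only on the map y. -/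
open Finset MeasureTheory
open scoped Classical

/-- The horizontal-ink formula: sum over vertices `v` of
`max_{u ∈ N⁻(v) ∪ {v}} x(u) − min_{u ∈ N⁻(v) ∪ {v}} x(u)`. -/
noncomputable def inkX {V : Type*} [Fintype V] (E : V → V → Prop) (x : V → ℤ) : ℤ :=
  ∑ v : V, (((insert v (Finset.univ.filter (fun u => E u v))).sup'
                (Finset.insert_nonempty _ _) x) -
            ((insert v (Finset.univ.filter (fun u => E u v))).inf'
                (Finset.insert_nonempty _ _) x))

/-- The vertical-ink formula: sum over vertices `v` of
`max_{w ∈ N⁺(v) ∪ {v}} y(w) − min_{w ∈ N⁺(v) ∪ {v}} y(w)`. -/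
noncomputable def inkY {V : Type*} [Fintype V] (E : V → V → Prop) (y : V → ℤ) : ℤ :=
  ∑ v : V, (((insert v (Finset.univ.filter (fun w => E v w))).sup'
                (Finset.insert_nonempty _ _) y) -
            ((insert v (Finset.univ.filter (fun w => E v w))).inf'
                (Finset.insert_nonempty _ _) y))

/-- The union of the horizontal edge segments lying on the row `y v`:
the horizontal segment of an edge `(a,b)` lies on the row `y b` and spans the
columns between `x a` and `x b`. -/
def rowSegs {V : Type*} (E : V → V → Prop) (x y : V → ℤ) (v : V) : Set ℝ :=
  {t : ℝ | ∃ a b, E a b ∧ y b = y v ∧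
    t ∈ Set.Icc ((min (x a) (x b) : ℤ) : ℝ) ((max (x a) (x b) : ℤ) : ℝ)}

/-- The union of the vertical edge segments lying on the column `x v`:
the vertical segment of an edge `(a,b)` lies on the column `x a` and spans the
rows between `y a` and `y b`. -/
def colSegs {V : Type*} (E : V → V → Prop) (x y : V → ℤ) (v : V) : Set ℝ :=
  {t : ℝ | ∃ a b, E a b ∧ x a = x v ∧
    t ∈ Set.Icc ((min (y a) (y b) : ℤ) : ℝ) ((max (y a) (y b) : ℤ) : ℝ)}

/-- The union of the segments joining `f v` to the values of `f` on `s` is as long as the interval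
spanned by the values of `f` on `insert v s`. -/
theorem volume_star_segments {V : Type*} (s : Finset V) (f : V → ℤ) (v : V) :
    (volume {t : ℝ | ∃ a ∈ s,
      t ∈ Set.Icc ((min (f a) (f v) : ℤ) : ℝ) ((max (f a) (f v) : ℤ) : ℝ)}).toReal =
    (((insert v s).sup' (Finset.insert_nonempty _ _) f -
      (insert v s).inf' (Finset.insert_nonempty _ _) f : ℤ) : ℝ) := by
  rcases s.eq_empty_or_nonempty with rfl | hs
  · simp
  obtain ⟨p, hp, hpM⟩ := Finset.exists_mem_eq_sup' (Finset.insert_nonempty v s) f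
  obtain ⟨q, hq, hqm⟩ := Finset.exists_mem_eq_inf' (Finset.insert_nonempty v s) f
  have hle : ∀ a ∈ insert v s, f q ≤ f a ∧ f a ≤ f p := fun a ha =>
    ⟨hqm ▸ Finset.inf'_le f ha, hpM ▸ Finset.le_sup' f ha⟩
  have hcover : {t : ℝ | ∃ a ∈ s,
      t ∈ Set.Icc ((min (f a) (f v) : ℤ) : ℝ) ((max (f a) (f v) : ℤ) : ℝ)} =
      Set.Icc (f q : ℝ) (f p : ℝ) := by
    have hv := hle v (Finset.mem_insert_self v s)
    have hvR : (f q : ℝ) ≤ f v ∧ (f v : ℝ) ≤ f p := by exact_mod_cast hv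
    ext t
    simp only [Set.mem_ofPred_eq, Set.mem_Icc, Int.cast_min, Int.cast_max, min_le_iff, le_max_iff]
    constructor
    · rintro ⟨a, ha, h1, h2⟩
      have haR : (f q : ℝ) ≤ f a ∧ (f a : ℝ) ≤ f p := by
        exact_mod_cast hle a (Finset.mem_insert_of_mem ha)
      constructor
      · rcases h1 with h | h <;> linarith
      · rcases h2 with h | h <;> linarith
    · rintro ⟨h1, h2⟩
      obtain ⟨c, hc⟩ := hs
      rcases le_total t (f v) with h | h
      · rcases Finset.mem_insert.1 hq with rfl | hq
        · exact ⟨c, hc, Or.inr h1, Or.inr h⟩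
        · exact ⟨q, hq, Or.inl h1, Or.inr h⟩
      · rcases Finset.mem_insert.1 hp with rfl | hp
        · exact ⟨c, hc, Or.inr h, Or.inr h2⟩
        · exact ⟨p, hp, Or.inr h, Or.inl h2⟩
  have hpq : (f q : ℝ) ≤ f p := by exact_mod_cast (hle p hp).1
  rw [hcover, hpM, hqm, Real.volume_Icc, ENNReal.toReal_ofReal (sub_nonneg.2 hpq), Int.cast_sub]

theorem sum_volume_rowSegs {V : Type*} [Fintype V] (E : V → V → Prop) (x y : V → ℤ)
    (hy : Function.Injective y) :
    (∑ v : V, (volume (rowSegs E x y v)).toReal) = ((inkX E x : ℤ) : ℝ) := by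
  rw [inkX, Int.cast_sum]
  refine Finset.sum_congr rfl fun v _ => ?_
  rw [← volume_star_segments]
  congr 2
  ext t
  simp only [rowSegs, Set.mem_ofPred_eq, hy.eq_iff, Finset.mem_filter, Finset.mem_univ, true_and]
  constructor
  · rintro ⟨a, b, hab, rfl, ht⟩
    exact ⟨a, hab, ht⟩
  · rintro ⟨a, hab, ht⟩
    exact ⟨a, v, hab, rfl, ht⟩

/-- Reversing every edge exchanges the two directions of an L-drawing. -/
theorem colSegs_eq_rowSegs {V : Type*} (E : V → V → Prop) (x y : V → ℤ) (v : V) :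
    colSegs E x y v = rowSegs (fun a b => E b a) y x v := by
  ext t
  constructor
  · rintro ⟨a, b, hab, hv, ht⟩
    exact ⟨b, a, hab, hv, by rwa [min_comm, max_comm]⟩
  · rintro ⟨a, b, hab, hv, ht⟩
    exact ⟨b, a, hab, hv, by rwa [min_comm, max_comm]⟩

theorem sum_volume_colSegs {V : Type*} [Fintype V] (E : V → V → Prop) (x y : V → ℤ)
    (hx : Function.Injective x) :
    (∑ v : V, (volume (colSegs E x y v)).toReal) = ((inkY E y : ℤ) : ℝ) := by
  simp only [colSegs_eq_rowSegs]
  exact sum_volume_rowSegs (fun a b => E b a) y x hx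

/-- For an L-drawing (injective `x`, `y`) of a finite loopless directed
graph `E`, the horizontal ink (sum over `v` of the length of the union of the
horizontal segments on row `y v`) equals `Σ_v (max_{u ∈ N⁻(v) ∪ {v}} x u − min_{u ∈ N⁻(v) ∪ {v}} x u)`,
and the vertical ink equals `Σ_v (max_{w ∈ N⁺(v) ∪ {v}} y w − min_{w ∈ N⁺(v) ∪ {v}} y w)`;
consequently the horizontal ink is unchanged if `y` is replaced by any other injective
map, and symmetrically for the vertical ink. -/
theorem stmt1 {V : Type*} [Fintype V] (E : V → V → Prop)
    (hloopless : ∀ u, ¬ E u u)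
    (x y : V → ℤ) (hx : Function.Injective x) (hy : Function.Injective y) :
    (∑ v : V, (volume (rowSegs E x y v)).toReal) = ((inkX E x : ℤ) : ℝ) ∧
    (∑ v : V, (volume (colSegs E x y v)).toReal) = ((inkY E y : ℤ) : ℝ) ∧
    (∀ y' : V → ℤ, Function.Injective y' →
      (∑ v : V, (volume (rowSegs E x y' v)).toReal) =
        (∑ v : V, (volume (rowSegs E x y v)).toReal)) ∧
    (∀ x' : V → ℤ, Function.Injective x' →
      (∑ v : V, (volume (colSegs E x' y v)).toReal) =
        (∑ v : V, (volume (colSegs E x y v)).toReal)) := by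
  exact ⟨sum_volume_rowSegs E x y hy, sum_volume_colSegs E x y hx,
    fun y' hy' => (sum_volume_rowSegs E x y' hy').trans (sum_volume_rowSegs E x y hy).symm,
    fun x' hx' => (sum_volume_colSegs E x' y hx').trans (sum_volume_colSegs E x y hx).symm⟩
end

section
/- Let K_n be the complete directed graph on n ≥ 1 vertices. Every L-drawing of K_n, i.e., every pair of injective maps x, y : V → ℤ, has ink at least 2n(n−1), with equality if and only if both the image of x and the image of y are sets of n consecutive integers. -/
open Finset
open scoped Classical

/-- In the complete digraph every in-neighborhood together with its vertex is everything. -/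
lemma insert_filter_ne_left {V : Type*} [Fintype V] (v : V) :
    insert v (univ.filter (fun u => u ≠ v)) = univ := by
  ext u
  simp [em]

/-- In the complete digraph every out-neighborhood together with its vertex is everything. -/
lemma insert_filter_ne_right {V : Type*} [Fintype V] (v : V) :
    insert v (univ.filter (fun u => v ≠ u)) = univ := by
  ext u
  simp [eq_comm, em]

/-- The vertical ink of a complete digraph equals its horizontal ink. -/
lemma inkY_ne_eq_inkX_ne {V : Type*} [Fintype V] (f : V → ℤ) :
    inkY (fun u v : V => u ≠ v) f = inkX (fun u v : V => u ≠ v) f := by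
  simp only [inkX, inkY, insert_filter_ne_left, insert_filter_ne_right]

/-- The ink of a complete digraph is the number of vertices times the spread of the labelling. -/
lemma inkX_ne_eq_card_mul {V : Type*} [Fintype V] (h : (univ : Finset V).Nonempty)
    (f : V → ℤ) :
    inkX (fun u v : V => u ≠ v) f =
      (Fintype.card V : ℤ) * (univ.sup' h f - univ.inf' h f) := by
  simp only [inkX, insert_filter_ne_left]
  exact (sum_const (univ.sup' h f - univ.inf' h f)).trans (by rw [card_univ, nsmul_eq_mul])

/-- The image of an integer labelling lies between its minimum and its maximum. -/
lemma image_subset_Icc_inf'_sup' {V : Type*} [Fintype V] (h : (univ : Finset V).Nonempty)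
    (f : V → ℤ) : univ.image f ⊆ Icc (univ.inf' h f) (univ.sup' h f) := by
  intro z hz
  obtain ⟨v, -, rfl⟩ := mem_image.1 hz
  exact mem_Icc.2 ⟨inf'_le _ (mem_univ v), le_sup' _ (mem_univ v)⟩

/-- An injective integer labelling spreads over at least `card V - 1`. -/
lemma card_sub_one_le_sup'_sub_inf' {V : Type*} [Fintype V] (h : (univ : Finset V).Nonempty)
    {f : V → ℤ} (hf : Function.Injective f) :
    (Fintype.card V : ℤ) - 1 ≤ univ.sup' h f - univ.inf' h f := by
  have hc := card_le_card (image_subset_Icc_inf'_sup' h f)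
  have hpos : 0 < Fintype.card V := by simpa using h.card_pos
  rw [card_image_of_injective _ hf, card_univ, Int.card_Icc] at hc
  omega

/-- The spread of an injective integer labelling is `card V - 1` exactly when its image is an
interval. -/
lemma sup'_sub_inf'_eq_iff {V : Type*} [Fintype V] (h : (univ : Finset V).Nonempty)
    {f : V → ℤ} (hf : Function.Injective f) :
    univ.sup' h f - univ.inf' h f = (Fintype.card V : ℤ) - 1 ↔
      ∃ a : ℤ, univ.image f = Icc a (a + (Fintype.card V : ℤ) - 1) := by
  constructor
  · intro heq
    refine ⟨univ.inf' h f, ?_⟩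
    have hs : univ.inf' h f + (Fintype.card V : ℤ) - 1 = univ.sup' h f := by omega
    rw [hs]
    apply eq_of_subset_of_card_le (image_subset_Icc_inf'_sup' h f)
    rw [card_image_of_injective _ hf, card_univ, Int.card_Icc]
    omega
  · rintro ⟨a, ha⟩
    have hmem (v : V) : a ≤ f v ∧ f v ≤ a + (Fintype.card V : ℤ) - 1 :=
      mem_Icc.1 (ha ▸ mem_image_of_mem f (mem_univ v))
    have hsup := sup'_le h f (fun v _ => (hmem v).2)
    have hinf := le_inf' h f (fun v _ => (hmem v).1)
    have := card_sub_one_le_sup'_sub_inf' h hf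
    omega

/-- Every L-drawing (injective `x`, `y`) of the complete directed
graph `K_n` (`n ≥ 1`) has ink at least `2n(n−1)`, with equality if and only if
both the image of `x` and the image of `y` are sets of `n` consecutive integers. -/
theorem stmt5 {V : Type*} [Fintype V] (n : ℕ) (hn : 1 ≤ n)
    (hcard : Fintype.card V = n) (x y : V → ℤ)
    (hx : Function.Injective x) (hy : Function.Injective y) :
    2 * (n : ℤ) * ((n : ℤ) - 1) ≤
        inkX (fun u v : V => u ≠ v) x + inkY (fun u v : V => u ≠ v) y ∧
    (inkX (fun u v : V => u ≠ v) x + inkY (fun u v : V => u ≠ v) y =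
        2 * (n : ℤ) * ((n : ℤ) - 1) ↔
      (∃ a : ℤ, Finset.univ.image x = Finset.Icc a (a + (n : ℤ) - 1)) ∧
      (∃ b : ℤ, Finset.univ.image y = Finset.Icc b (b + (n : ℤ) - 1))) := by
  subst hcard
  have h : (univ : Finset V).Nonempty := card_pos.1 (by rwa [card_univ])
  rw [inkY_ne_eq_inkX_ne, inkX_ne_eq_card_mul h, inkX_ne_eq_card_mul h,
    ← sup'_sub_inf'_eq_iff h hx, ← sup'_sub_inf'_eq_iff h hy]
  have hX := card_sub_one_le_sup'_sub_inf' h hx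
  have hY := card_sub_one_le_sup'_sub_inf' h hy
  have hpos : (0 : ℤ) < Fintype.card V := by exact_mod_cast hn
  generalize univ.sup' h x - univ.inf' h x = p at *
  generalize univ.sup' h y - univ.inf' h y = q at *
  generalize (Fintype.card V : ℤ) = m at *
  refine ⟨by nlinarith, fun heq => ?_, ?_⟩
  · have hsum : p + q = 2 * (m - 1) :=
      mul_left_cancel₀ hpos.ne' (by linarith)
    constructor <;> linarith
  · rintro ⟨rfl, rfl⟩
    ring
end

section
/- Let H = (V,F) be a finite simple undirected graph with |V| = n ≥ 1, let p = (5n² + 9n + 2)/2, and let G' be the directed graph of the reduction: its vertex set is V' = A ⊔ {n_u : u ∈ V} ⊔ B where A and B are disjoint sets of p vertices with distinguished vertices v₁ ∈ A and v₂ ∈ B, and its edges are: all ordered pairs of distinct vertices within A; all ordered pairs of distinct vertices within B; for each u ∈ V the edges (n_u, v₁), (n_u, v₂), (v₂, n_u); and for each {u,w} ∈ F both edges (n_u, n_w) and (n_w, n_u). Let π : V → {1, …, n} be any bijection and consider the L-drawing of G' given by bijections x, y : V' → {1, …, 2p+n} such that: x maps A onto {1, …, p} with x(v₁) = p, x(n_u)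 = p + π(u) for each u ∈ V, and x maps B onto {p+n+1, …, 2p+n} with x(v₂) = p+n+1; y maps B onto {1, …, p} with y(v₂) = p, y maps {n_u : u ∈ V} onto {p+1, …, p+n} by an arbitrary bijection, and y maps A onto {p+n+1, …, 2p+n} with y(v₁) = p+n+1. Then the ink of this drawing equals 4p(p−1) + (3n² + 9n)/2 + Σ_{u ∈ V} (π(u) − min_{v ∈ N(u) ∪ {u}} π(v)), where N(u) is the set of neighbors of u in H. -/
open Finset
open scoped Classical

/-- The directed graph `G'` of the reduction, on vertex set
`A ⊔ {n_u : u ∈ V} ⊔ B` with `A = B = Fin p`: all ordered pairs of distinct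
vertices within `A`; all ordered pairs of distinct vertices within `B`; for each
`u ∈ V` the edges `(n_u, v₁)`, `(n_u, v₂)`, `(v₂, n_u)`; and for each edge
`{u,w}` of `H` both `(n_u, n_w)` and `(n_w, n_u)`. -/
def reductionE {V : Type*} (H : SimpleGraph V) (p : ℕ) (v₁ v₂ : Fin p) :
    (Fin p ⊕ V ⊕ Fin p) → (Fin p ⊕ V ⊕ Fin p) → Prop
  | Sum.inl a, Sum.inl a' => a ≠ a'
  | Sum.inr (Sum.inr b), Sum.inr (Sum.inr b') => b ≠ b'
  | Sum.inr (Sum.inl _), Sum.inl a => a = v₁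
  | Sum.inr (Sum.inl _), Sum.inr (Sum.inr b) => b = v₂
  | Sum.inr (Sum.inr b), Sum.inr (Sum.inl _) => b = v₂
  | Sum.inr (Sum.inl u), Sum.inr (Sum.inl w) => H.Adj u w
  | _, _ => False

theorem Finset.sup'_sub_inf'_insert_filter {α : Type*} [Fintype α] [DecidableEq α] (P : α → Prop)
    [DecidablePred P] (f : α → ℤ) (v i j : α) (hi : i = v ∨ P i) (hj : j = v ∨ P j)
    (hv : f i ≤ f v ∧ f v ≤ f j) (h : ∀ k, P k → f i ≤ f k ∧ f k ≤ f j) :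
    (insert v (univ.filter P)).sup' (insert_nonempty _ _) f -
      (insert v (univ.filter P)).inf' (insert_nonempty _ _) f = f j - f i := by
  have hb : ∀ k ∈ insert v (univ.filter P), f i ≤ f k ∧ f k ≤ f j := by
    intro k hk
    rcases mem_insert.1 hk with rfl | hk
    · exact hv
    · exact h k (mem_filter.1 hk).2
  congr 1
  · exact le_antisymm (sup'_le _ _ fun k hk => (hb k hk).2) (le_sup' f (by simpa using hj))
  · exact le_antisymm (inf'_le f (by simpa using hi)) (le_inf' _ _ fun k hk => (hb k hk).1)

theorem two_mul_sum_of_bijOn_Icc {V : Type*} [Fintype V] (π : V → ℤ) (n : ℕ)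
    (hπ : Set.BijOn π Set.univ (Set.Icc 1 (n : ℤ))) :
    2 * ∑ u, π u = (n : ℤ) * (n + 1) := by
  have h : ∑ u, π u = ∑ k ∈ Icc 1 n, (k : ℤ) := by
    refine sum_bij (fun u _ => (π u).toNat) ?_ ?_ ?_ ?_
    · intro u _
      have := hπ.mapsTo (Set.mem_univ u)
      simp only [Set.mem_Icc, mem_Icc] at *
      omega
    · intro u _ w _ huw
      have hu := hπ.mapsTo (Set.mem_univ u)
      have hw := hπ.mapsTo (Set.mem_univ w)
      simp only [Set.mem_Icc] at hu hw
      exact hπ.injOn (Set.mem_univ u) (Set.mem_univ w) (by omega)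
    · intro k hk
      obtain ⟨u, -, hu⟩ := hπ.surjOn (show (k : ℤ) ∈ Set.Icc 1 (n : ℤ) by
        simp only [Set.mem_Icc, mem_Icc] at *
        omega)
      exact ⟨u, mem_univ u, by simp [hu]⟩
    · intro u _
      have := hπ.mapsTo (Set.mem_univ u)
      simp only [Set.mem_Icc] at this
      omega
  have hs : ∀ m : ℕ, 2 * ∑ k ∈ Icc 1 m, (k : ℤ) = (m : ℤ) * (m + 1) := by
    intro m
    induction m with
    | zero => simp
    | succ m ih =>
      rw [sum_Icc_succ_top (by omega), mul_add, ih]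
      push_cast
      ring
  rw [h, hs]

/-- Horizontal ink of `reductionE` when `x` places `A`, the `n_u` in the order `π`, then `B`. -/
theorem inkX_reductionE {V : Type*} [Fintype V] (H : SimpleGraph V) (n p : ℕ) (v₁ v₂ : Fin p)
    (π : V → ℤ) (hπ : Set.BijOn π Set.univ (Set.Icc 1 (n : ℤ))) (hn : 1 ≤ n)
    (x : (Fin p ⊕ V ⊕ Fin p) → ℤ)
    (hxA : Set.BijOn (fun a : Fin p => x (Sum.inl a)) Set.univ (Set.Icc 1 (p : ℤ)))
    (hxv₁ : x (Sum.inl v₁) = (p : ℤ))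
    (hxm : ∀ u : V, x (Sum.inr (Sum.inl u)) = (p : ℤ) + π u)
    (hxB : Set.BijOn (fun b : Fin p => x (Sum.inr (Sum.inr b))) Set.univ
            (Set.Icc ((p : ℤ) + n + 1) (2 * p + n)))
    (hxv₂ : x (Sum.inr (Sum.inr v₂)) = (p : ℤ) + n + 1) :
    inkX (reductionE H p v₁ v₂) x =
      2 * (p : ℤ) * (p - 1) + 2 * n + ∑ u : V, ((n : ℤ) + 1 -
        (insert u (univ.filter (fun v => H.Adj u v))).inf' (insert_nonempty _ _) π) := by
  have hp : 1 ≤ p := by have := v₁.isLt; omega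
  have hA : ∀ a, 1 ≤ x (Sum.inl a) ∧ x (Sum.inl a) ≤ p := fun a => hxA.mapsTo (Set.mem_univ a)
  have hB : ∀ b, (p : ℤ) + n + 1 ≤ x (Sum.inr (Sum.inr b)) ∧ x (Sum.inr (Sum.inr b)) ≤ 2 * p + n :=
    fun b => hxB.mapsTo (Set.mem_univ b)
  have hM : ∀ u, 1 ≤ π u ∧ π u ≤ n := fun u => hπ.mapsTo (Set.mem_univ u)
  obtain ⟨a₀, -, ha₀⟩ := hxA.surjOn (show (1 : ℤ) ∈ Set.Icc 1 (p : ℤ) by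
    simp only [Set.mem_Icc]; omega)
  obtain ⟨b₁, -, hb₁⟩ := hxB.surjOn
    (show (2 * p + n : ℤ) ∈ Set.Icc ((p : ℤ) + n + 1) (2 * p + n) by
      simp only [Set.mem_Icc]; omega)
  obtain ⟨u₀, -, hu₀⟩ := hπ.surjOn (show (1 : ℤ) ∈ Set.Icc 1 (n : ℤ) by
    simp only [Set.mem_Icc]; omega)
  obtain ⟨u₁, -, hu₁⟩ := hπ.surjOn (show (n : ℤ) ∈ Set.Icc 1 (n : ℤ) by
    simp only [Set.mem_Icc]; omega)
  simp only at ha₀ hb₁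
  have termA : ∀ a : Fin p, (insert (Sum.inl a) (univ.filter
      (fun u => reductionE H p v₁ v₂ u (Sum.inl a)))).sup' (insert_nonempty _ _) x -
      (insert (Sum.inl a) (univ.filter
      (fun u => reductionE H p v₁ v₂ u (Sum.inl a)))).inf' (insert_nonempty _ _) x =
      (p : ℤ) - 1 + if a = v₁ then (n : ℤ) else 0 := by
    intro a
    split_ifs with ha
    · subst ha
      rw [sup'_sub_inf'_insert_filter _ x _ (Sum.inl a₀) (Sum.inr (Sum.inl u₁))]
      · rw [hxm, hu₁, ha₀]; ring
      · simp only [reductionE, Sum.inl.injEq]; exact em _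
      · simp [reductionE]
      · have := hA a; have := hM u₁; simp only [hxm]; omega
      · rintro (k | k | k) hk
        · have := hA k; have := hM u₁; simp only [hxm]; omega
        · have := hM k; simp only [hxm]; omega
        · simp [reductionE] at hk
    · rw [sup'_sub_inf'_insert_filter _ x _ (Sum.inl a₀) (Sum.inl v₁)]
      · rw [hxv₁, ha₀]; ring
      · simp only [reductionE, Sum.inl.injEq]; exact em _
      · simp only [reductionE, Sum.inl.injEq]; exact em _
      · have := hA a; omega
      · rintro (k | k | k) hk
        · have := hA k; omega
        · simp [reductionE, ha] at hk
        · simp [reductionE] at hk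
  have termB : ∀ b : Fin p, (insert (Sum.inr (Sum.inr b)) (univ.filter
      (fun u => reductionE H p v₁ v₂ u (Sum.inr (Sum.inr b))))).sup' (insert_nonempty _ _) x -
      (insert (Sum.inr (Sum.inr b)) (univ.filter
      (fun u => reductionE H p v₁ v₂ u (Sum.inr (Sum.inr b))))).inf' (insert_nonempty _ _) x =
      (p : ℤ) - 1 + if b = v₂ then (n : ℤ) else 0 := by
    intro b
    split_ifs with hb
    · subst hb
      rw [sup'_sub_inf'_insert_filter _ x _ (Sum.inr (Sum.inl u₀)) (Sum.inr (Sum.inr b₁))]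
      · rw [hxm, hu₀, hb₁]; ring
      · simp [reductionE]
      · simp only [reductionE, Sum.inr.injEq]; exact em _
      · have := hB b; have := hM u₀; simp only [hxm]; omega
      · rintro (k | k | k) hk
        · simp [reductionE] at hk
        · have := hM k; simp only [hxm]; omega
        · have := hB k; have := hM u₀; simp only [hxm]; omega
    · rw [sup'_sub_inf'_insert_filter _ x _ (Sum.inr (Sum.inr v₂)) (Sum.inr (Sum.inr b₁))]
      · rw [hxv₂, hb₁]; ring
      · simp only [reductionE, Sum.inr.injEq]; exact em _
      · simp only [reductionE, Sum.inr.injEq]; exact em _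
      · have := hB b; omega
      · rintro (k | k | k) hk
        · simp [reductionE] at hk
        · simp [reductionE, hb] at hk
        · have := hB k; omega
  have termM : ∀ u : V, (insert (Sum.inr (Sum.inl u)) (univ.filter
      (fun w => reductionE H p v₁ v₂ w (Sum.inr (Sum.inl u))))).sup' (insert_nonempty _ _) x -
      (insert (Sum.inr (Sum.inl u)) (univ.filter
      (fun w => reductionE H p v₁ v₂ w (Sum.inr (Sum.inl u))))).inf' (insert_nonempty _ _) x =
      (n : ℤ) + 1 -
        (insert u (univ.filter (fun v => H.Adj u v))).inf' (insert_nonempty _ _) π := by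
    intro u
    obtain ⟨w, hw, hwm⟩ := exists_mem_eq_inf' (insert_nonempty u (univ.filter (H.Adj u))) π
    have hmin : ∀ k ∈ insert u (univ.filter (H.Adj u)), π w ≤ π k := fun k hk =>
      hwm ▸ inf'_le π hk
    rw [hwm, sup'_sub_inf'_insert_filter _ x _ (Sum.inr (Sum.inl w)) (Sum.inr (Sum.inr v₂))]
    · rw [hxm, hxv₂]; ring
    · simpa [reductionE, H.adj_comm u] using hw
    · simp [reductionE]
    · have := hmin u (mem_insert_self _ _); have := hM u; simp only [hxm]; omega
    · rintro (k | k | k) hk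
      · simp [reductionE] at hk
      · have := hmin k (mem_insert_of_mem (by simpa [reductionE, H.adj_comm u] using hk))
        have := hM k; simp only [hxm]; omega
      · simp only [reductionE] at hk
        subst hk
        have := hM w; simp only [hxm]; omega
  have hink : inkX (reductionE H p v₁ v₂) x =
      ∑ v, Sum.elim (fun a : Fin p => (p : ℤ) - 1 + if a = v₁ then (n : ℤ) else 0)
        (Sum.elim (fun u : V => (n : ℤ) + 1 -
        (insert u (univ.filter (fun v => H.Adj u v))).inf' (insert_nonempty _ _) π)
          (fun b : Fin p => (p : ℤ) - 1 + if b = v₂ then (n : ℤ) else 0)) v := by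
    refine sum_congr rfl ?_
    rintro (a | u | b) -
    · simp only [Sum.elim_inl]
      convert termA a
    · simp only [Sum.elim_inl, Sum.elim_inr]
      convert termM u
    · simp only [Sum.elim_inr]
      convert termB b
  rw [hink]
  simp only [Fintype.sum_sum_type, Sum.elim_inl, Sum.elim_inr,
    sum_add_distrib (s := univ (α := Fin p))]
  simp
  ring

/-- Vertical ink of `reductionE` when `y` places `B`, the `n_u` in any order, then `A`. -/
theorem inkY_reductionE {V : Type*} [Fintype V] (H : SimpleGraph V) (n p : ℕ)
    (hcard : Fintype.card V = n) (hn : 1 ≤ n) (v₁ v₂ : Fin p)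
    (y : (Fin p ⊕ V ⊕ Fin p) → ℤ)
    (hyB : Set.BijOn (fun b : Fin p => y (Sum.inr (Sum.inr b))) Set.univ
            (Set.Icc 1 (p : ℤ)))
    (hyv₂ : y (Sum.inr (Sum.inr v₂)) = (p : ℤ))
    (hym : Set.BijOn (fun u : V => y (Sum.inr (Sum.inl u))) Set.univ
            (Set.Icc ((p : ℤ) + 1) ((p : ℤ) + n)))
    (hyA : Set.BijOn (fun a : Fin p => y (Sum.inl a)) Set.univ
            (Set.Icc ((p : ℤ) + n + 1) (2 * p + n)))
    (hyv₁ : y (Sum.inl v₁) = (p : ℤ) + n + 1) :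
    inkY (reductionE H p v₁ v₂) y =
      2 * (p : ℤ) * (p - 1) + n + n * (n + 1) := by
  have hp : 1 ≤ p := by have := v₁.isLt; omega
  have hA : ∀ a, (p : ℤ) + n + 1 ≤ y (Sum.inl a) ∧ y (Sum.inl a) ≤ 2 * p + n :=
    fun a => hyA.mapsTo (Set.mem_univ a)
  have hB : ∀ b, 1 ≤ y (Sum.inr (Sum.inr b)) ∧ y (Sum.inr (Sum.inr b)) ≤ p :=
    fun b => hyB.mapsTo (Set.mem_univ b)
  have hM : ∀ u, (p : ℤ) + 1 ≤ y (Sum.inr (Sum.inl u)) ∧ y (Sum.inr (Sum.inl u)) ≤ p + n :=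
    fun u => hym.mapsTo (Set.mem_univ u)
  obtain ⟨a₁, -, ha₁⟩ := hyA.surjOn
    (show (2 * p + n : ℤ) ∈ Set.Icc ((p : ℤ) + n + 1) (2 * p + n) by
      simp only [Set.mem_Icc]; omega)
  obtain ⟨b₀, -, hb₀⟩ := hyB.surjOn (show (1 : ℤ) ∈ Set.Icc 1 (p : ℤ) by
    simp only [Set.mem_Icc]; omega)
  obtain ⟨u₁, -, hu₁⟩ := hym.surjOn
    (show (p + n : ℤ) ∈ Set.Icc ((p : ℤ) + 1) ((p : ℤ) + n) by
      simp only [Set.mem_Icc]; omega)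
  simp only at ha₁ hb₀ hu₁
  have termA : ∀ a : Fin p, (insert (Sum.inl a) (univ.filter
      (fun w => reductionE H p v₁ v₂ (Sum.inl a) w))).sup' (insert_nonempty _ _) y -
      (insert (Sum.inl a) (univ.filter
      (fun w => reductionE H p v₁ v₂ (Sum.inl a) w))).inf' (insert_nonempty _ _) y =
      (p : ℤ) - 1 := by
    intro a
    rw [sup'_sub_inf'_insert_filter _ y _ (Sum.inl v₁) (Sum.inl a₁)]
    · rw [hyv₁, ha₁]; ring
    · simp only [reductionE, Sum.inl.injEq, eq_comm (b := a)]; exact em _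
    · simp only [reductionE, Sum.inl.injEq, eq_comm (b := a)]; exact em _
    · have := hA a; omega
    · rintro (k | k | k) hk
      · have := hA k; omega
      · simp [reductionE] at hk
      · simp [reductionE] at hk
  have termB : ∀ b : Fin p, (insert (Sum.inr (Sum.inr b)) (univ.filter
      (fun w => reductionE H p v₁ v₂ (Sum.inr (Sum.inr b)) w))).sup' (insert_nonempty _ _) y -
      (insert (Sum.inr (Sum.inr b)) (univ.filter
      (fun w => reductionE H p v₁ v₂ (Sum.inr (Sum.inr b)) w))).inf' (insert_nonempty _ _) y =
      (p : ℤ) - 1 + if b = v₂ then (n : ℤ) else 0 := by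
    intro b
    split_ifs with hb
    · subst hb
      rw [sup'_sub_inf'_insert_filter _ y _ (Sum.inr (Sum.inr b₀)) (Sum.inr (Sum.inl u₁))]
      · rw [hu₁, hb₀]; ring
      · simp only [reductionE, Sum.inr.injEq, eq_comm (b := b)]; exact em _
      · simp [reductionE]
      · have := hB b; omega
      · rintro (k | k | k) hk
        · simp [reductionE] at hk
        · have := hM k; omega
        · have := hB k; omega
    · rw [sup'_sub_inf'_insert_filter _ y _ (Sum.inr (Sum.inr b₀)) (Sum.inr (Sum.inr v₂))]
      · rw [hyv₂, hb₀]; ring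
      · simp only [reductionE, Sum.inr.injEq, eq_comm (b := b)]; exact em _
      · simp only [reductionE, Sum.inr.injEq, eq_comm (b := b)]; exact em _
      · have := hB b; omega
      · rintro (k | k | k) hk
        · simp [reductionE] at hk
        · simp [reductionE, hb] at hk
        · have := hB k; omega
  have termM : ∀ u : V, (insert (Sum.inr (Sum.inl u)) (univ.filter
      (fun w => reductionE H p v₁ v₂ (Sum.inr (Sum.inl u)) w))).sup' (insert_nonempty _ _) y -
      (insert (Sum.inr (Sum.inl u)) (univ.filter
      (fun w => reductionE H p v₁ v₂ (Sum.inr (Sum.inl u)) w))).inf' (insert_nonempty _ _) y =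
      (n : ℤ) + 1 := by
    intro u
    rw [sup'_sub_inf'_insert_filter _ y _ (Sum.inr (Sum.inr v₂)) (Sum.inl v₁)]
    · rw [hyv₁, hyv₂]; ring
    · simp [reductionE]
    · simp [reductionE]
    · have := hM u; omega
    · rintro (k | k | k) hk
      · simp only [reductionE] at hk
        subst hk; omega
      · have := hM k; omega
      · simp only [reductionE] at hk
        subst hk; omega
  have hink : inkY (reductionE H p v₁ v₂) y =
      ∑ v, Sum.elim (fun _ : Fin p => (p : ℤ) - 1)
        (Sum.elim (fun _ : V => (n : ℤ) + 1)
          (fun b : Fin p => (p : ℤ) - 1 + if b = v₂ then (n : ℤ) else 0)) v := by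
    refine sum_congr rfl ?_
    rintro (a | u | b) -
    · simp only [Sum.elim_inl]
      convert termA a
    · simp only [Sum.elim_inl, Sum.elim_inr]
      convert termM u
    · simp only [Sum.elim_inr]
      convert termB b
  rw [hink]
  simp only [Fintype.sum_sum_type, Sum.elim_inl, Sum.elim_inr,
    sum_add_distrib (s := univ (α := Fin p))]
  simp [hcard]
  ring

/-- For the reduction graph `G'` built from a simple graph `H` on
`n ≥ 1` vertices with `p = (5n² + 9n + 2)/2` (here `2p = 5n² + 9n + 2` and
`2q = 3n² + 9n`), consider the L-drawing determined by a bijection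
`π : V → {1, …, n}` as follows: `x` maps `A` onto `{1, …, p}` with `x v₁ = p`,
`x n_u = p + π u`, and maps `B` onto `{p+n+1, …, 2p+n}` with `x v₂ = p+n+1`;
`y` maps `B` onto `{1, …, p}` with `y v₂ = p`, maps `{n_u}` onto `{p+1, …, p+n}`
by an arbitrary bijection, and maps `A` onto `{p+n+1, …, 2p+n}` with
`y v₁ = p+n+1`. Then the ink of this drawing equals
`4p(p−1) + (3n² + 9n)/2 + Σ_u (π u − min_{v ∈ N(u) ∪ {u}} π v)`. -/
theorem stmt9 {V : Type*} [Fintype V] (H : SimpleGraph V)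
    (n : ℕ) (hn : 1 ≤ n) (hcard : Fintype.card V = n)
    (p q : ℕ) (hp : 2 * p = 5 * n ^ 2 + 9 * n + 2) (hq : 2 * q = 3 * n ^ 2 + 9 * n)
    (v₁ v₂ : Fin p)
    (π : V → ℤ) (hπ : Set.BijOn π Set.univ (Set.Icc 1 (n : ℤ)))
    (x y : (Fin p ⊕ V ⊕ Fin p) → ℤ)
    (hxA : Set.BijOn (fun a : Fin p => x (Sum.inl a)) Set.univ (Set.Icc 1 (p : ℤ)))
    (hxv₁ : x (Sum.inl v₁) = (p : ℤ))
    (hxm : ∀ u : V, x (Sum.inr (Sum.inl u)) = (p : ℤ) + π u)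
    (hxB : Set.BijOn (fun b : Fin p => x (Sum.inr (Sum.inr b))) Set.univ
            (Set.Icc ((p : ℤ) + n + 1) (2 * p + n)))
    (hxv₂ : x (Sum.inr (Sum.inr v₂)) = (p : ℤ) + n + 1)
    (hyB : Set.BijOn (fun b : Fin p => y (Sum.inr (Sum.inr b))) Set.univ
            (Set.Icc 1 (p : ℤ)))
    (hyv₂ : y (Sum.inr (Sum.inr v₂)) = (p : ℤ))
    (hym : Set.BijOn (fun u : V => y (Sum.inr (Sum.inl u))) Set.univ
            (Set.Icc ((p : ℤ) + 1) ((p : ℤ) + n)))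
    (hyA : Set.BijOn (fun a : Fin p => y (Sum.inl a)) Set.univ
            (Set.Icc ((p : ℤ) + n + 1) (2 * p + n)))
    (hyv₁ : y (Sum.inl v₁) = (p : ℤ) + n + 1) :
    inkX (reductionE H p v₁ v₂) x + inkY (reductionE H p v₁ v₂) y =
      4 * (p : ℤ) * ((p : ℤ) - 1) + (q : ℤ) +
        ∑ u : V, (π u -
          (insert u (Finset.univ.filter (fun v => H.Adj u v))).inf'
            (Finset.insert_nonempty _ _) π) := by
  rw [inkX_reductionE H n p v₁ v₂ π hπ hn x hxA hxv₁ hxm hxB hxv₂,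
    inkY_reductionE H n p hcard hn v₁ v₂ y hyB hyv₂ hym hyA hyv₁]
  have hsum := two_mul_sum_of_bijOn_Icc π n hπ
  have hq' : 2 * (q : ℤ) = 3 * n ^ 2 + 9 * n := by exact_mod_cast hq
  simp only [sum_sub_distrib, sum_const, card_univ, hcard, nsmul_eq_mul]
  linarith
end

section
/- Let H = (V,F) be a finite simple undirected graph with |V| = n ≥ 1 and let k be a nonnegative integer. Let p = (5n² + 9n + 2)/2 and let G' be the directed graph of the reduction: its vertex set is V' = A ⊔ {n_u : u ∈ V} ⊔ B where A and B are disjoint sets of p vertices with distinguished vertices v₁ ∈ A and v₂ ∈ B, and its edges are: all ordered pairs of distinct vertices within A; all ordered pairs of distinct vertices within B; for each u ∈ V the edges (n_u, v₁), (n_u, v₂), (v₂, n_u); and for each {u,w} ∈ F both edges (n_u, n_w) and (n_w, n_u). Then there exists a bijection π : V → {1, …, n} with profile cost Σ_{u ∈ V} (π(u) − min_{v ∈ N(u) ∪ {u}} π(v)) ≤ k if and only if G' admits an L-drawing with ink at most k' = k + 4p(p−1) + (3n² + 9n)/2. -/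
open Finset
open scoped Classical

open Function

/-- The extent of `f` on the closed out-neighborhood of `v` with respect to `E`. -/
noncomputable def spread {W : Type*} [Fintype W] (E : W → W → Prop) (f : W → ℤ) (v : W) : ℤ :=
  (insert v (Finset.univ.filter (fun u => E v u))).sup' (Finset.insert_nonempty _ _) f -
    (insert v (Finset.univ.filter (fun u => E v u))).inf' (Finset.insert_nonempty _ _) f

theorem inkY_eq_sum_spread {W : Type*} [Fintype W] (E : W → W → Prop) (y : W → ℤ) :
    inkY E y = ∑ v, spread E y v := rfl

theorem inkX_eq_sum_spread {W : Type*} [Fintype W] (E : W → W → Prop) (x : W → ℤ) :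
    inkX E x = ∑ v, spread (swap E) x v := rfl

section Spread

variable {W : Type*} [Fintype W] {E : W → W → Prop} {f : W → ℤ} {v : W}

theorem spread_le {lo hi : ℤ} (h : ∀ u, u = v ∨ E v u → lo ≤ f u ∧ f u ≤ hi) :
    spread E f v ≤ hi - lo := by
  unfold spread
  apply sub_le_sub
  · exact Finset.sup'_le _ _ fun u hu => (h u (by simpa using hu)).2
  · exact Finset.le_inf' _ _ fun u hu => (h u (by simpa using hu)).1

theorem sub_le_spread {i j : W} (hi : i = v ∨ E v i) (hj : j = v ∨ E v j) :
    f i - f j ≤ spread E f v := by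
  unfold spread
  apply sub_le_sub
  · exact Finset.le_sup' f (by simpa using hi)
  · exact Finset.inf'_le f (by simpa using hj)

theorem spread_nonneg : 0 ≤ spread E f v := by
  simpa using sub_le_spread (E := E) (f := f) (v := v) (Or.inl rfl) (Or.inl rfl)

theorem card_sub_one_le_spread {ι : Type*} [Fintype ι] (hf : Injective f) {g : ι → W}
    (hg : Injective g) (h : ∀ i, g i = v ∨ E v (g i)) :
    (Fintype.card ι : ℤ) - 1 ≤ spread E f v := by
  have hsub : Finset.univ.image (f ∘ g) ⊆
      Finset.Icc ((insert v (Finset.univ.filter (fun u => E v u))).inf'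
        (Finset.insert_nonempty _ _) f)
        ((insert v (Finset.univ.filter (fun u => E v u))).sup'
        (Finset.insert_nonempty _ _) f) := by
    intro m hm
    obtain ⟨i, -, rfl⟩ := Finset.mem_image.1 hm
    exact Finset.mem_Icc.2 ⟨Finset.inf'_le f (by simpa using h i),
      Finset.le_sup' f (by simpa using h i)⟩
  have hcard := Finset.card_le_card hsub
  rw [Finset.card_image_of_injective _ (hf.comp hg), Finset.card_univ, Int.card_Icc] at hcard
  have := spread_nonneg (E := E) (f := f) (v := v)
  unfold spread at this ⊢
  omega

end Spread

theorem card_lt_of_mem_Ioo {ι : Type*} [Fintype ι] [Nonempty ι] {g : ι → ℤ} (hg : Injective g)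
    {lo hi : ℤ} (h : ∀ i, lo < g i ∧ g i < hi) : (Fintype.card ι : ℤ) + 1 ≤ hi - lo := by
  have hcard := Finset.card_le_card (s := Finset.univ.image g) (t := Finset.Ioo lo hi) (by
    intro m hm
    obtain ⟨i, -, rfl⟩ := Finset.mem_image.1 hm
    exact Finset.mem_Ioo.2 (h i))
  rw [Finset.card_image_of_injective _ hg, Finset.card_univ, Int.card_Ioo] at hcard
  have := h (Classical.arbitrary ι)
  omega

/-- An injective integer family attains its extremes, which are at distance at least
`card ι - 1`; in case of equality its range is an interval. -/
theorem exists_extremes {ι : Type*} [Fintype ι] [Nonempty ι] {g : ι → ℤ} (hg : Injective g) :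
    ∃ i j, (∀ l, g j ≤ g l ∧ g l ≤ g i) ∧ (Fintype.card ι : ℤ) - 1 ≤ g i - g j ∧
      (g i - g j = (Fintype.card ι : ℤ) - 1 → ∀ m, g j ≤ m → m ≤ g i → ∃ l, g l = m) := by
  obtain ⟨i, hi⟩ := Finite.exists_max g
  obtain ⟨j, hj⟩ := Finite.exists_min g
  have hsub : Finset.univ.image g ⊆ Finset.Icc (g j) (g i) := by
    intro m hm
    obtain ⟨l, -, rfl⟩ := Finset.mem_image.1 hm
    exact Finset.mem_Icc.2 ⟨hj l, hi l⟩
  have himage : (Finset.univ.image g).card = Fintype.card ι := by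
    rw [Finset.card_image_of_injective _ hg, Finset.card_univ]
  have hcard := Finset.card_le_card hsub
  rw [himage, Int.card_Icc] at hcard
  have := hj i
  refine ⟨i, j, fun l => ⟨hj l, hi l⟩, by omega, fun heq m hjm hmi => ?_⟩
  have himage_eq := Finset.eq_of_subset_of_card_le hsub (by rw [himage, Int.card_Icc]; omega)
  have hm : m ∈ Finset.univ.image g := himage_eq ▸ Finset.mem_Icc.2 ⟨hjm, hmi⟩
  obtain ⟨l, -, hl⟩ := Finset.mem_image.1 hm
  exact ⟨l, hl⟩

theorem lt_or_lt_of_notMem_range {ι W : Type*} {f : W → ℤ} (hf : Injective f) {g : ι → W}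
    {lo hi : ℤ} (h : ∀ m, lo ≤ m → m ≤ hi → ∃ l, f (g l) = m) {z : W} (hz : ∀ l, g l ≠ z) :
    f z < lo ∨ hi < f z := by
  by_contra! hcon
  obtain ⟨l, hl⟩ := h _ hcon.1 hcon.2
  exact hz l (hf hl)

/-- The rank function of an injective integer family; `m` is any strict upper bound of it. -/
theorem exists_rank {V : Type*} [Fintype V] {f : V → ℤ} (hf : Injective f) :
    ∃ π : V → ℤ, Set.BijOn π Set.univ (Set.Icc 1 (Fintype.card V : ℤ)) ∧
      ∀ m, (∀ u, f u < m) → ∀ w, (Fintype.card V : ℤ) + 1 - π w ≤ m - f w := by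
  let S : V → Finset V := fun u => Finset.univ.filter fun w => f w ≤ f u
  have hlt : ∀ {u w}, f u < f w → (S u).card < (S w).card := by
    intro u w huw
    apply Finset.card_lt_card
    refine Finset.ssubset_iff_subset_ne.2 ⟨fun z hz => ?_, fun heq => ?_⟩
    · simp only [S, Finset.mem_filter_univ] at hz ⊢
      omega
    · have hw : w ∈ S u := heq ▸ by simp [S]
      simp only [S, Finset.mem_filter_univ] at hw
      omega
  have hinj : Injective fun u => ((S u).card : ℤ) := by
    intro u w huw
    by_contra hne
    have hfne : f u ≠ f w := fun h => hne (hf h)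
    simp only [Nat.cast_inj] at huw
    rcases lt_or_gt_of_ne hfne with h | h
    · have := hlt h; omega
    · have := hlt h; omega
  have hmem : ∀ u, ((S u).card : ℤ) ∈ Finset.Icc 1 (Fintype.card V : ℤ) := by
    intro u
    have hpos : 0 < (S u).card := Finset.card_pos.2 ⟨u, by simp [S]⟩
    have hle := Finset.card_le_univ (S u)
    rw [Finset.mem_Icc]
    omega
  refine ⟨fun u => (S u).card, ⟨fun u _ => by simpa using hmem u, hinj.injOn, ?_⟩, ?_⟩
  · have himage : Finset.univ.image (fun u => ((S u).card : ℤ)) =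
        Finset.Icc 1 (Fintype.card V : ℤ) := by
      apply Finset.eq_of_subset_of_card_le
      · intro m hm
        obtain ⟨u, -, rfl⟩ := Finset.mem_image.1 hm
        exact hmem u
      · rw [Finset.card_image_of_injective _ hinj, Int.card_Icc, Finset.card_univ]
        omega
    intro m hm
    rw [← Finset.coe_Icc, ← himage] at hm
    simpa using hm
  · intro m hm w
    have hsub : ((S w)ᶜ).image f ⊆ Finset.Ioo (f w) m := by
      intro z hz
      obtain ⟨u, hu, rfl⟩ := Finset.mem_image.1 hz
      simp only [S, Finset.mem_compl, Finset.mem_filter_univ, not_le] at hu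
      exact Finset.mem_Ioo.2 ⟨hu, hm u⟩
    have hcard := Finset.card_le_card hsub
    rw [Finset.card_image_of_injective _ hf, Finset.card_compl, Int.card_Ioo] at hcard
    have := hm w
    have hle := Finset.card_le_univ (S w)
    dsimp only
    omega

theorem two_mul_sum_of_bijOn {V : Type*} [Fintype V] {π : V → ℤ} {n : ℕ}
    (hπ : Set.BijOn π Set.univ (Set.Icc 1 (n : ℤ))) : 2 * ∑ u, π u = n * (n + 1) := by
  have hsum : ∑ u, π u = ∑ m ∈ Finset.Icc 1 (n : ℤ), m := by
    refine Finset.sum_bij (fun u _ => π u) (fun u _ => ?_) (fun u _ w _ h => ?_) (fun m hm => ?_)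
      fun _ _ => rfl
    · simpa using hπ.mapsTo (Set.mem_univ u)
    · exact hπ.injOn (Set.mem_univ u) (Set.mem_univ w) h
    · obtain ⟨u, -, hu⟩ := hπ.surjOn (show m ∈ Set.Icc 1 (n : ℤ) by simpa using hm)
      exact ⟨u, Finset.mem_univ u, hu⟩
  rw [hsum]
  clear hsum hπ
  induction n with
  | zero => simp
  | succ n ih =>
    have hIcc : Finset.Icc 1 ((n + 1 : ℕ) : ℤ) = insert ((n : ℤ) + 1) (Finset.Icc 1 (n : ℤ)) := by
      ext m
      simp only [Finset.mem_Icc, Finset.mem_insert]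
      omega
    rw [hIcc, Finset.sum_insert (by simp), mul_add, ih]
    push_cast
    ring

theorem sub_le_sum_sub_card_mul {ι : Type*} [Fintype ι] {T : ι → ℤ} {c : ℤ} (h : ∀ i, c ≤ T i)
    (j : ι) : T j - c ≤ ∑ i, T i - Fintype.card ι * c := by
  have := Finset.single_le_sum (f := fun i => T i - c) (fun i _ => sub_nonneg.2 (h i))
    (Finset.mem_univ j)
  simpa [Finset.sum_sub_distrib] using this

theorem card_mul_le_sum {ι : Type*} [Fintype ι] {T : ι → ℤ} {c : ℤ} (h : ∀ i, c ≤ T i) :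
    Fintype.card ι * c ≤ ∑ i, T i := by
  simpa using Finset.card_nsmul_le_sum Finset.univ T c fun i _ => h i

section Reduction

variable {V : Type*} {H : SimpleGraph V} {p : ℕ} {v₁ v₂ : Fin p}

theorem eq_or_reductionE_inl (a a' : Fin p) :
    (.inl a' : Fin p ⊕ V ⊕ Fin p) = .inl a ∨ reductionE H p v₁ v₂ (.inl a) (.inl a') := by
  by_cases h : a = a' <;> simp [reductionE, h]

theorem eq_or_reductionE_inr (b b' : Fin p) :
    (.inr (.inr b') : Fin p ⊕ V ⊕ Fin p) = .inr (.inr b) ∨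
      reductionE H p v₁ v₂ (.inr (.inr b)) (.inr (.inr b')) := by
  by_cases h : b = b' <;> simp [reductionE, h]

variable [Fintype V]

variable (H) in

/-- The profile cost of `π`. -/
noncomputable def profileCost (π : V → ℤ) : ℤ :=
  ∑ u : V, (π u - (insert u (Finset.univ.filter (fun v => H.Adj u v))).inf'
    (Finset.insert_nonempty _ _) π)

variable (H) in
theorem exists_bijOn_profileCost_le {n : ℕ} (hcard : Fintype.card V = n) :
    ∃ π : V → ℤ, Set.BijOn π Set.univ (Set.Icc 1 (n : ℤ)) ∧
      2 * profileCost H π ≤ n * (n - 1) := by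
  obtain ⟨π, hπ, -⟩ := exists_rank (f := fun u => ((Fintype.equivFin V u : ℕ) : ℤ)) (by
    intro u w h
    simpa [Fin.val_inj] using h)
  rw [hcard] at hπ
  refine ⟨π, hπ, ?_⟩
  have hle : profileCost H π ≤ ∑ u, (π u - 1) :=
    Finset.sum_le_sum fun u _ => sub_le_sub_left
      (Finset.le_inf' _ _ fun w _ => (hπ.mapsTo (Set.mem_univ w)).1) _
  have hsum := two_mul_sum_of_bijOn hπ
  simp only [Finset.sum_sub_distrib, Finset.sum_const, Finset.card_univ, hcard, nsmul_eq_mul,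
    mul_one] at hle
  linarith

theorem exists_drawing_of_bijOn {n : ℕ} (hcard : Fintype.card V = n) {π : V → ℤ}
    (hπ : Set.BijOn π Set.univ (Set.Icc 1 (n : ℤ))) :
    ∃ x : (Fin p ⊕ V ⊕ Fin p) → ℤ, Injective x ∧
      2 * (inkX (reductionE H p v₁ v₂) x + inkY (reductionE H p v₁ v₂) x) ≤
        2 * profileCost H π + 8 * p * (p - 1) + 3 * n ^ 2 + 9 * n := by
  have hp0 : 0 < p := v₁.pos
  let e₁ : Fin p → ℤ := fun a => ((Equiv.swap v₁ ⟨0, hp0⟩ a : Fin p) : ℕ)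
  let e₂ : Fin p → ℤ := fun b => ((Equiv.swap v₂ ⟨0, hp0⟩ b : Fin p) : ℕ)
  have he₁ : ∀ a, 0 ≤ e₁ a ∧ e₁ a ≤ p - 1 := fun a => by simp only [e₁]; omega
  have he₂ : ∀ b, 0 ≤ e₂ b ∧ e₂ b ≤ p - 1 := fun b => by simp only [e₂]; omega
  have he₁v : e₁ v₁ = 0 := by simp [e₁]
  have he₂v : e₂ v₂ = 0 := by simp [e₂]
  have hi₁ : Injective e₁ := fun a a' h => by simpa [e₁, Fin.val_inj] using h
  have hi₂ : Injective e₂ := fun a a' h => by simpa [e₂, Fin.val_inj] using h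
  have hπr : ∀ u, 1 ≤ π u ∧ π u ≤ n := fun u => hπ.mapsTo (Set.mem_univ u)
  let x : (Fin p ⊕ V ⊕ Fin p) → ℤ :=
    Sum.elim (fun a => -e₁ a) (Sum.elim π fun b => n + 1 + e₂ b)
  have hx : Injective x := by
    rintro (a | u | b) (a' | u' | b') h <;> simp only [x, Sum.elim_inl, Sum.elim_inr] at h
    · rw [hi₁ (neg_injective h)]
    · have := he₁ a; have := hπr u'; omega
    · have := he₁ a; have := he₂ b'; omega
    · have := he₁ a'; have := hπr u; omega
    · rw [hπ.injOn (Set.mem_univ u) (Set.mem_univ u') h]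
    · have := hπr u; have := he₂ b'; omega
    · have := he₁ a'; have := he₂ b; omega
    · have := hπr u'; have := he₂ b; omega
    · rw [hi₂ (add_left_cancel h)]
  have hXA : ∀ a, spread (swap (reductionE H p v₁ v₂)) x (.inl a) ≤
      p - 1 + if a = v₁ then (n : ℤ) else 0 := by
    intro a
    have : spread (swap (reductionE H p v₁ v₂)) x (.inl a) ≤
      (if a = v₁ then (n : ℤ) else 0) - (-(p - 1)) := by
      refine spread_le ?_
      rintro (a' | u | b) h
      · have := he₁ a'
        simp only [x, Sum.elim_inl]
        split_ifs <;> omega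
      · have := hπr u
        have : a = v₁ := by simpa [swap, reductionE] using h
        simp only [x, Sum.elim_inl, Sum.elim_inr, this, if_true]
        omega
      · simp [swap, reductionE] at h
    linarith
  have hYA : ∀ a, spread (reductionE H p v₁ v₂) x (.inl a) ≤ p - 1 := by
    intro a
    have : spread (reductionE H p v₁ v₂) x (.inl a) ≤ 0 - (-(p - 1)) := by
      refine spread_le ?_
      rintro (a' | u | b) h
      · have := he₁ a'
        simp only [x, Sum.elim_inl]
        omega
      · simp [reductionE] at h
      · simp [reductionE] at h
    linarith
  have hXB : ∀ b, spread (swap (reductionE H p v₁ v₂)) x (.inr (.inr b)) ≤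
      p - 1 + if b = v₂ then (n : ℤ) else 0 := by
    intro b
    have : spread (swap (reductionE H p v₁ v₂)) x (.inr (.inr b)) ≤
      (n + p : ℤ) - (n + 1 - if b = v₂ then (n : ℤ) else 0) := by
      refine spread_le ?_
      rintro (a | u | b') h
      · simp [swap, reductionE] at h
      · have := hπr u
        have : b = v₂ := by simpa [swap, reductionE] using h
        simp only [x, Sum.elim_inl, Sum.elim_inr, this, if_true]
        omega
      · have := he₂ b'
        simp only [x, Sum.elim_inr]
        split_ifs <;> omega
    linarith
  have hYB : ∀ b, spread (reductionE H p v₁ v₂) x (.inr (.inr b)) ≤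
      p - 1 + if b = v₂ then (n : ℤ) else 0 := by
    intro b
    have : spread (reductionE H p v₁ v₂) x (.inr (.inr b)) ≤
      (n + p : ℤ) - (n + 1 - if b = v₂ then (n : ℤ) else 0) := by
      refine spread_le ?_
      rintro (a | u | b') h
      · simp [reductionE] at h
      · have := hπr u
        have : b = v₂ := by simpa [reductionE] using h
        simp only [x, Sum.elim_inl, Sum.elim_inr, this, if_true]
        omega
      · have := he₂ b'
        simp only [x, Sum.elim_inr]
        split_ifs <;> omega
    linarith
  have hXN : ∀ u, spread (swap (reductionE H p v₁ v₂)) x (.inr (.inl u)) ≤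
      (n + 1 : ℤ) - (insert u (Finset.univ.filter (fun v => H.Adj u v))).inf'
        (Finset.insert_nonempty _ _) π := by
    intro u
    refine spread_le ?_
    rintro (a | w | b) h
    · simp [swap, reductionE] at h
    · have := hπr w
      refine ⟨Finset.inf'_le π ?_, ?_⟩
      · simpa [swap, reductionE, H.adj_comm] using h
      · simp only [x, Sum.elim_inl, Sum.elim_inr]
        omega
    · have : b = v₂ := by simpa [swap, reductionE] using h
      simp only [x, Sum.elim_inr, this, he₂v, add_zero, le_refl, and_true]
      have := Finset.inf'_le (s := insert u (Finset.univ.filter (fun v => H.Adj u v))) π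
        (Finset.mem_insert_self _ _)
      have := hπr u
      omega
  have hYN : ∀ u, spread (reductionE H p v₁ v₂) x (.inr (.inl u)) ≤ (n + 1 : ℤ) := by
    intro u
    have : spread (reductionE H p v₁ v₂) x (.inr (.inl u)) ≤ (n + 1 : ℤ) - 0 := by
      refine spread_le ?_
      rintro (a | w | b) h
      · have : a = v₁ := by simpa [reductionE] using h
        simp only [x, Sum.elim_inl, this, he₁v]
        omega
      · have := hπr w
        simp only [x, Sum.elim_inl, Sum.elim_inr]
        omega
      · have : b = v₂ := by simpa [reductionE] using h
        simp only [x, Sum.elim_inr, this, he₂v]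
        omega
    linarith
  refine ⟨x, hx, ?_⟩
  have hsum := two_mul_sum_of_bijOn hπ
  have sXA := Finset.sum_le_sum fun a (_ : a ∈ Finset.univ) => hXA a
  have sYA := Finset.sum_le_sum fun a (_ : a ∈ Finset.univ) => hYA a
  have sXB := Finset.sum_le_sum fun a (_ : a ∈ Finset.univ) => hXB a
  have sYB := Finset.sum_le_sum fun a (_ : a ∈ Finset.univ) => hYB a
  have sXN := Finset.sum_le_sum fun a (_ : a ∈ Finset.univ) => hXN a
  have sYN := Finset.sum_le_sum fun a (_ : a ∈ Finset.univ) => hYN a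
  rw [inkX_eq_sum_spread, inkY_eq_sum_spread, profileCost]
  simp only [Fintype.sum_sum_type, Finset.sum_sub_distrib, Finset.sum_add_distrib,
    Finset.sum_const, Finset.card_univ, hcard, nsmul_eq_mul, Fintype.card_fin,
    Finset.sum_ite_eq', Finset.mem_univ, if_true, mul_one] at *
  nlinarith

theorem exists_bijOn_of_drawing {n : ℕ} (hn : 1 ≤ n) (hcard : Fintype.card V = n) {E : ℤ}
    (hEp : E < p) {x y : (Fin p ⊕ V ⊕ Fin p) → ℤ} (hx : Injective x) (hy : Injective y)
    (hink : inkX (reductionE H p v₁ v₂) x + inkY (reductionE H p v₁ v₂) y ≤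
      4 * p * (p - 1) + E) :
    ∃ π : V → ℤ, Set.BijOn π Set.univ (Set.Icc 1 (n : ℤ)) ∧
      2 * profileCost H π + 3 * n ^ 2 + 9 * n ≤ 2 * E := by
  have hp0 : 0 < p := v₁.pos
  have : Nonempty (Fin p) := ⟨v₁⟩
  have : Nonempty V := Fintype.card_pos_iff.1 (by omega)
  have hinr : Injective (fun b : Fin p => (.inr (.inr b) : Fin p ⊕ V ⊕ Fin p)) :=
    Sum.inr_injective.comp Sum.inr_injective
  have hmid : Injective (fun u : V => (.inr (.inl u) : Fin p ⊕ V ⊕ Fin p)) :=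
    Sum.inr_injective.comp Sum.inl_injective
  obtain ⟨a₁, a₀, ha, hal, haI⟩ := exists_extremes (hx.comp Sum.inl_injective)
  obtain ⟨b₁, b₀, hb, hbl, hbI⟩ := exists_extremes (hx.comp hinr)
  obtain ⟨c₁, c₀, hc, hcl, hcI⟩ := exists_extremes (hy.comp Sum.inl_injective)
  obtain ⟨d₁, d₀, hd, hdl, hdI⟩ := exists_extremes (hy.comp hinr)
  simp only [comp_apply, Fintype.card_fin] at *
  set R := reductionE H p v₁ v₂ with hR
  have hXA : ∀ a, x (.inl a₁) - x (.inl a₀) ≤ spread (swap R) x (.inl a) := fun a =>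
    sub_le_spread (by simp [swap, hR, reductionE, em]) (by simp [swap, hR, reductionE, em])
  have hXB : ∀ b, x (.inr (.inr b₁)) - x (.inr (.inr b₀)) ≤ spread (swap R) x (.inr (.inr b)) :=
    fun b =>
    sub_le_spread (by simp [swap, hR, reductionE, em]) (by simp [swap, hR, reductionE, em])
  have hYA : ∀ a, y (.inl c₁) - y (.inl c₀) ≤ spread R y (.inl a) := fun a =>
    sub_le_spread (eq_or_reductionE_inl _ _) (eq_or_reductionE_inl _ _)
  have hYB : ∀ b, y (.inr (.inr d₁)) - y (.inr (.inr d₀)) ≤ spread R y (.inr (.inr b)) :=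
    fun b => sub_le_spread (eq_or_reductionE_inr _ _)
      (eq_or_reductionE_inr _ _)
  have hXN : 0 ≤ ∑ u, spread (swap R) x (.inr (.inl u)) :=
    Finset.sum_nonneg fun _ _ => spread_nonneg
  have hYN : ∀ u, 0 ≤ spread R y (.inr (.inl u)) := fun _ => spread_nonneg
  rw [inkX_eq_sum_spread, inkY_eq_sum_spread] at hink
  simp only [Fintype.sum_sum_type] at hink
  have sXA := card_mul_le_sum hXA
  have sXB := card_mul_le_sum hXB
  have sYA := card_mul_le_sum hYA
  have sYB := card_mul_le_sum hYB
  have sYN := Finset.sum_nonneg fun u (_ : u ∈ Finset.univ) => hYN u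
  rw [Fintype.card_fin] at sXA sXB sYA sYB
  have htight : (x (.inl a₁) - x (.inl a₀)) + (x (.inr (.inr b₁)) - x (.inr (.inr b₀))) +
      (y (.inl c₁) - y (.inl c₀)) + (y (.inr (.inr d₁)) - y (.inr (.inr d₀))) <
      4 * (p - 1) + 1 := by
    have hpz : (0 : ℤ) < p := by exact_mod_cast hp0
    refine lt_of_mul_lt_mul_left ?_ hpz.le
    linarith
  have ha' : x (.inl a₁) - x (.inl a₀) = p - 1 := by omega
  have hb' : x (.inr (.inr b₁)) - x (.inr (.inr b₀)) = p - 1 := by omega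
  have hc' : y (.inl c₁) - y (.inl c₀) = p - 1 := by omega
  have hd' : y (.inr (.inr d₁)) - y (.inr (.inr d₀)) = p - 1 := by omega
  rw [ha'] at hXA sXA
  rw [hb'] at hXB sXB
  rw [hc'] at hYA sYA
  rw [hd'] at hYB sYB
  have eXA := sub_le_sum_sub_card_mul hXA v₁
  have eXB := sub_le_sum_sub_card_mul hXB v₂
  have eYB := sub_le_sum_sub_card_mul hYB v₂
  have eYN := sub_le_sum_sub_card_mul hYN
  simp only [Fintype.card_fin, mul_zero, sub_zero] at eXA eXB eYB eYN
  have bXA : spread (swap R) x (.inl v₁) ≤ p - 1 + E := by linarith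
  have bXB : spread (swap R) x (.inr (.inr v₂)) ≤ p - 1 + E := by linarith
  have bYB : spread R y (.inr (.inr v₂)) ≤ p - 1 + E := by linarith
  have bYN : ∀ u, spread R y (.inr (.inl u)) ≤ E := fun u => by linarith [eYN u]
  have cXA : (p : ℤ) + n - 1 ≤ spread (swap R) x (.inl v₁) := by
    have := card_sub_one_le_spread (E := swap R) (v := .inl v₁) hx
      (g := fun i : Fin p ⊕ V => Sum.elim .inl (fun u => .inr (.inl u)) i)
      (by rintro (a | u) (a' | u') h <;> simp_all)
      (by rintro (a | u) <;> simp [swap, hR, reductionE, em])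
    simpa [hcard] using this
  have cXB : (p : ℤ) + n - 1 ≤ spread (swap R) x (.inr (.inr v₂)) := by
    have := card_sub_one_le_spread (E := swap R) (v := .inr (.inr v₂)) hx
      (g := fun i : Fin p ⊕ V => Sum.elim (fun b => .inr (.inr b)) (fun u => .inr (.inl u)) i)
      (by rintro (a | u) (a' | u') h <;> simp_all)
      (by rintro (a | u) <;> simp [swap, hR, reductionE, em])
    simpa [hcard] using this
  have cYB : (p : ℤ) + n - 1 ≤ spread R y (.inr (.inr v₂)) := by
    have := card_sub_one_le_spread (E := R) (v := .inr (.inr v₂)) hy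
      (g := fun i : Fin p ⊕ V => Sum.elim (fun b => .inr (.inr b)) (fun u => .inr (.inl u)) i)
      (by rintro (a | u) (a' | u') h <;> simp_all)
      (by
        rintro (b | u)
        · exact eq_or_reductionE_inr _ _
        · simp [hR, reductionE])
    simpa [hcard] using this
  have hyN : ∀ u, (y (.inl v₁) < y (.inr (.inl u)) ∧ y (.inr (.inl u)) < y (.inr (.inr v₂))) ∨
      (y (.inr (.inr v₂)) < y (.inr (.inl u)) ∧ y (.inr (.inl u)) < y (.inl v₁)) := by
    intro u
    have gA := lt_or_lt_of_notMem_range hy (g := Sum.inl) (hcI hc') (z := .inr (.inl u)) (by simp)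
    have gB := lt_or_lt_of_notMem_range hy (g := fun b => .inr (.inr b)) (hdI hd')
      (z := .inr (.inl u)) (by simp)
    have gAB := lt_or_lt_of_notMem_range hy (g := Sum.inl) (hcI hc') (z := .inr (.inr d₀)) (by simp)
    have gBA := lt_or_lt_of_notMem_range hy (g := fun b => .inr (.inr b)) (hdI hd')
      (z := .inl c₀) (by simp)
    have := hc v₁
    have := hd v₂
    have := bYN u
    have hB₁ := sub_le_spread (E := R) (f := y) (v := .inr (.inr v₂)) (i := .inr (.inl u))
      (j := .inr (.inr d₀)) (by simp [hR, reductionE])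
      (eq_or_reductionE_inr _ _)
    have hB₂ := sub_le_spread (E := R) (f := y) (v := .inr (.inr v₂)) (i := .inr (.inr d₁))
      (j := .inr (.inl u)) (eq_or_reductionE_inr _ _)
      (by simp [hR, reductionE])
    have hN₁ := sub_le_spread (E := R) (f := y) (v := .inr (.inl u)) (i := .inr (.inl u))
      (j := .inl v₁) (by simp) (by simp [hR, reductionE])
    have hN₂ := sub_le_spread (E := R) (f := y) (v := .inr (.inl u)) (j := .inr (.inl u))
      (i := .inl v₁) (by simp [hR, reductionE]) (by simp)
    omega
  have hxN : (∀ u, x (.inr (.inl u)) < x (.inr (.inr v₂))) ∨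
      ∀ u, x (.inr (.inr v₂)) < x (.inr (.inl u)) := by
    have gAB := lt_or_lt_of_notMem_range hx (g := Sum.inl) (haI ha') (z := .inr (.inr b₀)) (by simp)
    have gBA := lt_or_lt_of_notMem_range hx (g := fun b => .inr (.inr b)) (hbI hb')
      (z := .inl a₀) (by simp)
    have hv := hb v₂
    have hpos : ∀ u, (x (.inl a₁) < x (.inr (.inr b₀)) →
        x (.inr (.inl u)) < x (.inr (.inr b₀))) ∧
        (x (.inr (.inr b₁)) < x (.inl a₀) → x (.inr (.inr b₁)) < x (.inr (.inl u))) := by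
      intro u
      have gB := lt_or_lt_of_notMem_range hx (g := fun b => .inr (.inr b)) (hbI hb')
        (z := .inr (.inl u)) (by simp)
      have hA₁ := sub_le_spread (E := swap R) (f := x) (v := .inl v₁) (i := .inr (.inl u))
        (j := .inl a₀) (by simp [swap, hR, reductionE]) (by simp [swap, hR, reductionE, em])
      have hA₂ := sub_le_spread (E := swap R) (f := x) (v := .inl v₁) (i := .inl a₁)
        (j := .inr (.inl u)) (by simp [swap, hR, reductionE, em]) (by simp [swap, hR, reductionE])
      omega
    rcases gAB with h | h
    · exact Or.inr fun u => hv.2.trans_lt ((hpos u).2 (by omega))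
    · exact Or.inl fun u => ((hpos u).1 h).trans_le hv.1
  have cYN : ∀ u, (n : ℤ) + 1 ≤ spread R y (.inr (.inl u)) := by
    intro u
    have h₁ := sub_le_spread (E := R) (f := y) (v := .inr (.inl u)) (i := .inr (.inr v₂))
      (j := .inl v₁) (by simp [hR, reductionE]) (by simp [hR, reductionE])
    have h₂ := sub_le_spread (E := R) (f := y) (v := .inr (.inl u)) (j := .inr (.inr v₂))
      (i := .inl v₁) (by simp [hR, reductionE]) (by simp [hR, reductionE])
    rw [← hcard]
    rcases lt_or_ge (y (.inl v₁)) (y (.inr (.inr v₂))) with h | h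
    · refine (card_lt_of_mem_Ioo (hy.comp hmid) fun w => ?_).trans h₁
      have := hyN w
      simp only [comp_apply]
      omega
    · refine (card_lt_of_mem_Ioo (hy.comp hmid) fun w => ?_).trans h₂
      have := hyN w
      simp only [comp_apply]
      omega
  have total : ∑ u, spread (swap R) x (.inr (.inl u)) + ∑ u, spread R y (.inr (.inl u)) ≤
      E - 3 * n := by linarith
  have key : ∀ {f : V → ℤ}, Injective f → ∀ m, (∀ u, f u < m) →
      (∀ u w, w = u ∨ H.Adj u w → m - f w ≤ spread (swap R) x (.inr (.inl u))) →
      ∃ π : V → ℤ, Set.BijOn π Set.univ (Set.Icc 1 (n : ℤ)) ∧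
        2 * profileCost H π + 3 * n ^ 2 + 9 * n ≤ 2 * E := by
    intro f hf m hm hspread
    obtain ⟨π, hπ, hrank⟩ := exists_rank hf
    rw [hcard] at hπ hrank
    refine ⟨π, hπ, ?_⟩
    have cXN : ∀ u, (n : ℤ) + 1 - (insert u (Finset.univ.filter (fun v => H.Adj u v))).inf'
        (Finset.insert_nonempty _ _) π ≤ spread (swap R) x (.inr (.inl u)) := by
      intro u
      obtain ⟨w, hw, hmin⟩ := Finset.exists_mem_eq_inf' (Finset.insert_nonempty u
        (Finset.univ.filter (fun v => H.Adj u v))) π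
      rw [hmin]
      exact (hrank m hm w).trans (hspread u w (by simpa using hw))
    have tXN := Finset.sum_le_sum fun u (_ : u ∈ Finset.univ) => cXN u
    have tYN := card_mul_le_sum cYN
    have hsum := two_mul_sum_of_bijOn hπ
    rw [profileCost]
    simp only [Finset.sum_sub_distrib, Finset.sum_const, Finset.card_univ, hcard,
      nsmul_eq_mul] at tXN tYN ⊢
    linarith only [tXN, tYN, hsum, total]
  rcases hxN with h | h
  · exact key (hx.comp hmid) _ h fun u w hw => sub_le_spread
      (by simp [swap, hR, reductionE]) (by simpa [swap, hR, reductionE, H.adj_comm] using hw)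
  · refine key (f := fun u => -x (.inr (.inl u))) (neg_injective.comp (hx.comp hmid))
      (-x (.inr (.inr v₂))) (fun u => neg_lt_neg (h u)) fun u w hw => ?_
    rw [neg_sub_neg]
    exact sub_le_spread (by simpa [swap, hR, reductionE, H.adj_comm] using hw)
      (by simp [swap, hR, reductionE])

end Reduction

/-- Let `H` be a simple graph on `n ≥ 1` vertices, `k ≥ 0`,
`p = (5n² + 9n + 2)/2` (here `2p = 5n² + 9n + 2` and `2q = 3n² + 9n`), and let
`G'` be the reduction graph. Then there is a bijection `π : V → {1, …, n}` with
profile cost at most `k` if and only if `G'` admits an L-drawing with ink at most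
`k' = k + 4p(p−1) + (3n² + 9n)/2`. -/
theorem stmt10 {V : Type*} [Fintype V] (H : SimpleGraph V)
    (n : ℕ) (hn : 1 ≤ n) (hcard : Fintype.card V = n) (k : ℕ)
    (p q : ℕ) (hp : 2 * p = 5 * n ^ 2 + 9 * n + 2) (hq : 2 * q = 3 * n ^ 2 + 9 * n)
    (v₁ v₂ : Fin p) :
    (∃ π : V → ℤ, Set.BijOn π Set.univ (Set.Icc 1 (n : ℤ)) ∧
        ∑ u : V, (π u -
          (insert u (Finset.univ.filter (fun v => H.Adj u v))).inf'
            (Finset.insert_nonempty _ _) π) ≤ (k : ℤ)) ↔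
    (∃ x y : (Fin p ⊕ V ⊕ Fin p) → ℤ,
        Function.Injective x ∧ Function.Injective y ∧
        inkX (reductionE H p v₁ v₂) x + inkY (reductionE H p v₁ v₂) y ≤
          (k : ℤ) + 4 * (p : ℤ) * ((p : ℤ) - 1) + (q : ℤ)) := by

  have hp' : 2 * (p : ℤ) = 5 * n ^ 2 + 9 * n + 2 := by exact_mod_cast hp
  have hq' : 2 * (q : ℤ) = 3 * n ^ 2 + 9 * n := by exact_mod_cast hq
  constructor
  · rintro ⟨π, hπ, hcost⟩
    obtain ⟨x, hx, hink⟩ := exists_drawing_of_bijOn (H := H) (v₁ := v₁) (v₂ := v₂) hcard hπ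
    rw [← profileCost] at hcost
    exact ⟨x, x, hx, hx, by linarith⟩
  · rintro ⟨x, y, hx, hy, hink⟩
    obtain ⟨π, hπ, hcost⟩ := exists_bijOn_profileCost_le H hcard
    by_cases hk : (n : ℤ) * (n - 1) ≤ 2 * k
    · exact ⟨π, hπ, show profileCost H π ≤ k by linarith⟩
    · have hkq : (k : ℤ) + q < p := by nlinarith
      obtain ⟨π, hπ, hcost⟩ := exists_bijOn_of_drawing hn hcard hkq hx hy (by linarith)
      exact ⟨π, hπ, show profileCost H π ≤ k by linarith⟩
end
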